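/- Let M be a real symmetric positive semidefinite N×N matrix with M ⪯ μ_n I and with vᵀ M v ≥ μ₂ ‖v‖₂² for every v orthogonal to ker M (μ_n ≥ μ₂ > 0). Let q : ℝ^N → ℝ be twice continuously differentiable such that for every λ there is a real symmetric matrix F(λ) with γI ⪯ F(λ) ⪯ ΓI (Γ ≥ γ > 0) and ∇²q(λ) = M F(λ)^{−1} M, and assume the Hessian is M-Lipschitz with constant B ≥ 0: ‖(∇²q(λ₁) − ∇²q(λ₂)) v‖_M ≤ B ‖λ₁ − λ₂‖_M ‖v‖_M for all λ₁, λ₂, v. Fix λ ∈ ℝ^N, set g = ∇q(λ) and H = M F(λ)^{−1} M, and suppose d* ∈ ℝ^N satisfies H d* = −g. Let ε ≥ 0, α ∈ [0,1], and let d̃ satisfy ‖d̃ − d*‖_H ≤ ε ‖d*‖_H. Then the gradient at the updated point λ⁺ = λ + α d̃ satisfies ‖∇q(λ⁺)‖_M ≤ [ 1 − α + ε α √((Γ/γ)(μ_n³/μ₂³)) ] ‖g‖_M + ( B (α(1+ε)Γ)² / (2 μ₂⁴) ) ‖g‖²_M. -/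

import Mathlib

open Matrix

/-- The gradient of `f` at `x`, expressed in coordinates via partial derivatives. -/
noncomputable def grad {N : ℕ} (f : (Fin N → ℝ) → ℝ) (x : Fin N → ℝ) : Fin N → ℝ :=
  fun i => fderiv ℝ f x (Pi.single i 1)

/-- The `M`-seminorm `‖v‖_M = √(vᵀ M v)` associated to a positive semidefinite matrix `M`. -/
noncomputable def mnorm {ι : Type*} [Fintype ι] (M : Matrix ι ι ℝ) (v : ι → ℝ) : ℝ :=
  Real.sqrt (v ⬝ᵥ M.mulVec v)

open scoped MatrixOrder in
theorem Matrix.PosSemidef.exists_symm_mul_self {ι : Type*} [Fintype ι] [DecidableEq ι]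
    {M : Matrix ι ι ℝ} (hM : M.PosSemidef) : ∃ S : Matrix ι ι ℝ, Sᵀ = S ∧ S * S = M := by
  refine ⟨CFC.sqrt M, ?_, CFC.sqrt_mul_sqrt_self M hM.nonneg⟩
  have h := (CFC.sqrt_nonneg M).isSelfAdjoint
  rwa [IsSelfAdjoint, Matrix.star_eq_conjTranspose, conjTranspose_eq_transpose_of_trivial] at h

section SqrtFactor

variable {ι : Type*} [Fintype ι] {M S : Matrix ι ι ℝ}

theorem dotProduct_mulVec_of_mul_self (hS : Sᵀ = S) (hSM : S * S = M) (u v : ι → ℝ) :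
    u ⬝ᵥ M *ᵥ v = (S *ᵥ u) ⬝ᵥ (S *ᵥ v) := by
  rw [← hSM, ← mulVec_mulVec, dotProduct_mulVec, ← mulVec_transpose, hS]

theorem mnorm_eq_norm_of_mul_self (hS : Sᵀ = S) (hSM : S * S = M) (v : ι → ℝ) :
    mnorm M v = ‖WithLp.toLp 2 (S *ᵥ v)‖ := by
  rw [mnorm, dotProduct_mulVec_of_mul_self hS hSM, EuclideanSpace.norm_eq]
  simp [dotProduct, sq]

end SqrtFactor

section Seminorm

variable {ι : Type*} [Fintype ι] {M : Matrix ι ι ℝ}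

theorem mnorm_nonneg (M : Matrix ι ι ℝ) (v : ι → ℝ) : 0 ≤ mnorm M v := Real.sqrt_nonneg _

theorem mnorm_sq (hM : M.PosSemidef) (v : ι → ℝ) : mnorm M v ^ 2 = v ⬝ᵥ M *ᵥ v :=
  Real.sq_sqrt (by simpa using hM.dotProduct_mulVec_nonneg v)

theorem mnorm_add_le [DecidableEq ι] (hM : M.PosSemidef) (u v : ι → ℝ) :
    mnorm M (u + v) ≤ mnorm M u + mnorm M v := by
  obtain ⟨S, hS, hSM⟩ := hM.exists_symm_mul_self
  simp only [mnorm_eq_norm_of_mul_self hS hSM, mulVec_add, WithLp.toLp_add]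
  exact norm_add_le _ _

theorem mnorm_smul [DecidableEq ι] (hM : M.PosSemidef) (c : ℝ) (v : ι → ℝ) :
    mnorm M (c • v) = |c| * mnorm M v := by
  obtain ⟨S, hS, hSM⟩ := hM.exists_symm_mul_self
  simp only [mnorm_eq_norm_of_mul_self hS hSM, mulVec_smul, WithLp.toLp_smul]
  rw [norm_smul, Real.norm_eq_abs]

theorem sq_dotProduct_mulVec_le [DecidableEq ι] (hM : M.PosSemidef) (u v : ι → ℝ) :
    (u ⬝ᵥ M *ᵥ v) ^ 2 ≤ (u ⬝ᵥ M *ᵥ u) * (v ⬝ᵥ M *ᵥ v) := by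
  obtain ⟨S, hS, hSM⟩ := hM.exists_symm_mul_self
  simp only [dotProduct_mulVec_of_mul_self hS hSM]
  simpa [dotProduct, sq] using
    Finset.sum_mul_sq_le_sq_mul_sq Finset.univ (S *ᵥ u) (S *ᵥ v)

theorem dotProduct_mulVec_le_of_posSemidef_sub [DecidableEq ι] {c : ℝ}
    (h : (c • (1 : Matrix ι ι ℝ) - M).PosSemidef) (v : ι → ℝ) :
    v ⬝ᵥ M *ᵥ v ≤ c * (v ⬝ᵥ v) := by
  have := h.dotProduct_mulVec_nonneg v
  simp only [star_trivial, sub_mulVec, smul_mulVec, one_mulVec, dotProduct_sub,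
    dotProduct_smul, smul_eq_mul] at this
  linarith

theorem le_dotProduct_mulVec_of_posSemidef_sub [DecidableEq ι] {c : ℝ}
    (h : (M - c • (1 : Matrix ι ι ℝ)).PosSemidef) (v : ι → ℝ) :
    c * (v ⬝ᵥ v) ≤ v ⬝ᵥ M *ᵥ v := by
  have := h.dotProduct_mulVec_nonneg v
  simp only [star_trivial, sub_mulVec, smul_mulVec, one_mulVec, dotProduct_sub,
    dotProduct_smul, smul_eq_mul] at this
  linarith

theorem mulVec_dotProduct_self_le [DecidableEq ι] (hM : M.PosSemidef) {c : ℝ}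
    (h : ∀ v, v ⬝ᵥ M *ᵥ v ≤ c * (v ⬝ᵥ v)) (v : ι → ℝ) :
    (M *ᵥ v) ⬝ᵥ (M *ᵥ v) ≤ c * (v ⬝ᵥ M *ᵥ v) := by
  obtain ⟨S, hS, hSM⟩ := hM.exists_symm_mul_self
  have h1 := h (S *ᵥ v)
  rw [dotProduct_mulVec_of_mul_self hS hSM, mulVec_mulVec, hSM] at h1
  rwa [dotProduct_mulVec_of_mul_self hS hSM v v]

theorem le_mulVec_dotProduct_self [DecidableEq ι] (hM : M.PosSemidef) {c : ℝ}
    (h : ∀ v : ι → ℝ, (∀ w : ι → ℝ, M *ᵥ w = 0 → v ⬝ᵥ w = 0) →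
      c * (v ⬝ᵥ v) ≤ v ⬝ᵥ M *ᵥ v) (v : ι → ℝ) :
    c * (v ⬝ᵥ M *ᵥ v) ≤ (M *ᵥ v) ⬝ᵥ (M *ᵥ v) := by
  obtain ⟨S, hS, hSM⟩ := hM.exists_symm_mul_self
  have h1 := h (S *ᵥ v) fun w hw => by
    have hSw : S *ᵥ w = 0 := by
      rw [← dotProduct_self_eq_zero, ← dotProduct_mulVec_of_mul_self hS hSM, hw,
        dotProduct_zero]
    rw [dotProduct_comm, ← hS, dotProduct_mulVec, vecMul_transpose, hSw, zero_dotProduct]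
  rw [dotProduct_mulVec_of_mul_self hS hSM (S *ᵥ v), mulVec_mulVec, hSM] at h1
  rwa [dotProduct_mulVec_of_mul_self hS hSM v v]

end Seminorm

/-- A second-order Taylor bound in the `M`-seminorm for a vector field whose derivative is
`M`-Lipschitz along a segment. -/
theorem mnorm_taylor_remainder_le {ι : Type*} [Fintype ι] [DecidableEq ι] {M : Matrix ι ι ℝ}
    (hM : M.PosSemidef) {G : (ι → ℝ) → ι → ℝ} {H : (ι → ℝ) → Matrix ι ι ℝ} {B : ℝ}
    (hG : ∀ x, HasFDerivAt G (LinearMap.toContinuousLinearMap (H x).mulVecLin) x)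
    (hLip : ∀ x y v : ι → ℝ,
      mnorm M ((H x - H y) *ᵥ v) ≤ B * mnorm M (x - y) * mnorm M v)
    (x s : ι → ℝ) :
    mnorm M (G (x + s) - G x - H x *ᵥ s) ≤ B / 2 * mnorm M s ^ 2 := by
  obtain ⟨S, hS, hSM⟩ := hM.exists_symm_mul_self
  let L : (ι → ℝ) →L[ℝ] EuclideanSpace ℝ ι :=
    (EuclideanSpace.equiv ι ℝ).symm.toContinuousLinearMap.comp
      (LinearMap.toContinuousLinearMap S.mulVecLin)
  have hL : ∀ v, mnorm M v = ‖L v‖ := mnorm_eq_norm_of_mul_self hS hSM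
  let f : ℝ → EuclideanSpace ℝ ι := fun t => L (G (x + t • s) - G x - t • (H x *ᵥ s))
  have hf : ∀ t, HasDerivAt f (L ((H (x + t • s) - H x) *ᵥ s)) t := fun t => by
    have h1 : HasDerivAt (fun t : ℝ => x + t • s) s t := by
      simpa using ((hasDerivAt_id t).smul_const s).const_add x
    have h2 := (hG (x + t • s)).comp_hasDerivAt t h1
    have h3 : HasDerivAt (fun t : ℝ => t • (H x *ᵥ s)) (H x *ᵥ s) t := by
      simpa using (hasDerivAt_id t).smul_const (H x *ᵥ s)
    have h4 := L.hasFDerivAt.comp_hasDerivAt t ((h2.sub_const (G x)).sub h3)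
    rw [sub_mulVec]
    exact h4
  have hb : ∀ t : ℝ, HasDerivAt (fun t : ℝ => B / 2 * mnorm M s ^ 2 * t ^ 2)
      (B * mnorm M s ^ 2 * t) t := fun t => by
    refine ((hasDerivAt_pow 2 t).const_mul (B / 2 * mnorm M s ^ 2)).congr_deriv ?_
    push_cast
    ring
  have key := image_norm_le_of_norm_deriv_right_le_deriv_boundary
    (f := f) (a := 0) (b := 1)
    (fun t _ => (hf t).continuousAt.continuousWithinAt)
    (fun t _ => (hf t).hasDerivWithinAt) (by simp [f])
    hb (fun t ht => by
      rw [← hL]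
      refine (hLip _ _ _).trans_eq ?_
      rw [add_sub_cancel_left, mnorm_smul hM, abs_of_nonneg ht.1]
      ring) (Set.right_mem_Icc.2 zero_le_one)
  simpa only [f, ← hL, one_smul, one_pow, mul_one] using key

theorem posDef_of_posSemidef_sub_smul_one {ι : Type*} [DecidableEq ι] {F : Matrix ι ι ℝ} {γ : ℝ}
    (hγ : 0 < γ)
    (hF : (F - γ • (1 : Matrix ι ι ℝ)).PosSemidef) : F.PosDef := by
  simpa using PosDef.posSemidef_add hF (PosDef.one.smul hγ)

section ReducedHessian

variable {ι : Type*} [Fintype ι] [DecidableEq ι] {M F : Matrix ι ι ℝ} {γ Γ μn μ₂ : ℝ}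

theorem posSemidef_mul_inv_mul (hM : M.PosSemidef) (hF : F.PosDef) :
    (M * F⁻¹ * M).PosSemidef := by
  have h := hF.inv.posSemidef.conjTranspose_mul_mul_same M
  rwa [hM.isHermitian.eq] at h

theorem dotProduct_mul_inv_mul_mulVec (hM : M.PosSemidef) (u v : ι → ℝ) :
    u ⬝ᵥ (M * F⁻¹ * M) *ᵥ v = (M *ᵥ u) ⬝ᵥ (F⁻¹ *ᵥ M *ᵥ v) := by
  have hMt : Mᵀ = M := by simpa using hM.isHermitian.eq
  rw [← mulVec_mulVec, ← mulVec_mulVec, dotProduct_mulVec, ← mulVec_transpose, hMt]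

theorem dotProduct_mul_inv_mul_mulVec_self (hM : M.PosSemidef) (hF : F.PosDef) (v : ι → ℝ) :
    v ⬝ᵥ (M * F⁻¹ * M) *ᵥ v = (F⁻¹ *ᵥ M *ᵥ v) ⬝ᵥ F *ᵥ (F⁻¹ *ᵥ M *ᵥ v) := by
  rw [dotProduct_mul_inv_mul_mulVec hM, mulVec_mulVec _ F,
    mul_nonsing_inv F ((isUnit_iff_isUnit_det F).1 hF.isUnit), one_mulVec, dotProduct_comm]

theorem mnorm_sq_mul_inv_mul_mulVec_le (hM : M.PosSemidef) (hγ : 0 < γ) (hμn : 0 ≤ μn)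
    (hMub : (μn • (1 : Matrix ι ι ℝ) - M).PosSemidef)
    (hF : (F - γ • (1 : Matrix ι ι ℝ)).PosSemidef) (v : ι → ℝ) :
    mnorm M ((M * F⁻¹ * M) *ᵥ v) ^ 2 ≤ μn ^ 3 / γ * mnorm (M * F⁻¹ * M) v ^ 2 := by
  have hFp := posDef_of_posSemidef_sub_smul_one hγ hF
  rw [mnorm_sq hM, mnorm_sq (posSemidef_mul_inv_mul hM hFp),
    dotProduct_mul_inv_mul_mulVec_self hM hFp, ← mulVec_mulVec, ← mulVec_mulVec]
  set y := F⁻¹ *ᵥ M *ᵥ v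
  have hle := dotProduct_mulVec_le_of_posSemidef_sub hMub
  calc (M *ᵥ y) ⬝ᵥ M *ᵥ (M *ᵥ y) ≤ μn * ((M *ᵥ y) ⬝ᵥ (M *ᵥ y)) := hle _
    _ ≤ μn * (μn * (μn * (y ⬝ᵥ y))) := by
        gcongr
        exact (mulVec_dotProduct_self_le hM hle y).trans (by gcongr; exact hle y)
    _ = μn ^ 3 / γ * (γ * (y ⬝ᵥ y)) := by field_simp
    _ ≤ μn ^ 3 / γ * (y ⬝ᵥ F *ᵥ y) := by
        gcongr
        exact le_dotProduct_mulVec_of_posSemidef_sub hF y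

theorem mnorm_sq_le_mul_inv_mul (hM : M.PosSemidef) (hμ₂ : 0 < μ₂)
    (hMlb : ∀ v : ι → ℝ, (∀ w : ι → ℝ, M *ᵥ w = 0 → v ⬝ᵥ w = 0) →
      μ₂ * (v ⬝ᵥ v) ≤ v ⬝ᵥ M *ᵥ v)
    (hFp : F.PosDef) (hF : (Γ • (1 : Matrix ι ι ℝ) - F).PosSemidef) (v : ι → ℝ) :
    mnorm M v ^ 2 ≤ Γ / μ₂ * mnorm (M * F⁻¹ * M) v ^ 2 := by
  have h1 := le_mulVec_dotProduct_self hM hMlb v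
  have h2 := mulVec_dotProduct_self_le hFp.posSemidef
    (dotProduct_mulVec_le_of_posSemidef_sub hF) (F⁻¹ *ᵥ M *ᵥ v)
  rw [← dotProduct_mul_inv_mul_mulVec_self hM hFp, mulVec_mulVec _ F,
    mul_nonsing_inv F ((isUnit_iff_isUnit_det F).1 hFp.isUnit), one_mulVec] at h2
  rw [mnorm_sq hM, mnorm_sq (posSemidef_mul_inv_mul hM hFp), div_mul_eq_mul_div,
    le_div_iff₀ hμ₂]
  linarith

theorem mnorm_mul_inv_mul_sq_le (hM : M.PosSemidef) (hμ₂ : 0 < μ₂) (hΓ : 0 ≤ Γ)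
    (hMlb : ∀ v : ι → ℝ, (∀ w : ι → ℝ, M *ᵥ w = 0 → v ⬝ᵥ w = 0) →
      μ₂ * (v ⬝ᵥ v) ≤ v ⬝ᵥ M *ᵥ v)
    (hFp : F.PosDef) (hF : (Γ • (1 : Matrix ι ι ℝ) - F).PosSemidef) (v : ι → ℝ) :
    mnorm (M * F⁻¹ * M) v ^ 2 ≤ Γ / μ₂ ^ 3 * mnorm M ((M * F⁻¹ * M) *ᵥ v) ^ 2 := by
  have h1 := mnorm_sq_le_mul_inv_mul hM hμ₂ hMlb hFp hF v
  rw [mnorm_sq hM] at h1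
  set w := mnorm (M * F⁻¹ * M) v ^ 2 with hw
  have hw0 : 0 ≤ w := sq_nonneg _
  set y := F⁻¹ *ᵥ M *ᵥ v with hy
  have hHv : (M * F⁻¹ * M) *ᵥ v = M *ᵥ y := by rw [← mulVec_mulVec, ← mulVec_mulVec]
  have hwy : w = v ⬝ᵥ M *ᵥ y := by
    rw [hw, mnorm_sq (posSemidef_mul_inv_mul hM hFp), hHv]
  have h2 := sq_dotProduct_mulVec_le hM v y
  rw [← hwy] at h2
  have h3 := le_mulVec_dotProduct_self hM hMlb y
  have h4 : μ₂ * ((M *ᵥ y) ⬝ᵥ (M *ᵥ y)) ≤ mnorm M (M *ᵥ y) ^ 2 := by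
    rw [mnorm_sq hM]
    exact hMlb _ fun u hu => by
      have hMt : Mᵀ = M := by simpa using hM.isHermitian.eq
      rw [dotProduct_comm, ← hMt, dotProduct_mulVec, vecMul_transpose, hu, zero_dotProduct]
  rw [hHv]
  set n := mnorm M (M *ᵥ y) ^ 2
  have hy0 : 0 ≤ y ⬝ᵥ M *ᵥ y := by rw [← mnorm_sq hM]; positivity
  have h5 : y ⬝ᵥ M *ᵥ y ≤ n / μ₂ ^ 2 := by
    rw [le_div_iff₀ (by positivity)]
    nlinarith
  have h6 : w * w ≤ w * (Γ / μ₂ ^ 3 * n) := by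
    calc w * w = w ^ 2 := (sq w).symm
      _ ≤ (Γ / μ₂ * w) * (n / μ₂ ^ 2) := h2.trans (by gcongr)
      _ = w * (Γ / μ₂ ^ 3 * n) := by field_simp
  rcases hw0.eq_or_lt with h | h
  · rw [← h]
    positivity
  · exact le_of_mul_le_mul_left h6 h

end ReducedHessian

theorem dual_gradient_change
    {N : ℕ} (M : Matrix (Fin N) (Fin N) ℝ) (hM : M.PosSemidef)
    (μn μ₂ γ Γ B : ℝ)
    (hμ₂ : 0 < μ₂) (hμ : μ₂ ≤ μn) (hγ : 0 < γ) (hΓ : γ ≤ Γ) (hB : 0 ≤ B)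
    (hMub : (μn • (1 : Matrix (Fin N) (Fin N) ℝ) - M).PosSemidef)
    (hMlb : ∀ v : Fin N → ℝ, (∀ w : Fin N → ℝ, M.mulVec w = 0 → v ⬝ᵥ w = 0) →
      μ₂ * (∑ i, v i ^ 2) ≤ v ⬝ᵥ M.mulVec v)
    (q : (Fin N → ℝ) → ℝ) (hq : ContDiff ℝ 2 q)
    (F : (Fin N → ℝ) → Matrix (Fin N) (Fin N) ℝ)
    (hFsymm : ∀ l, (F l).IsSymm)
    (hFlb : ∀ l, (F l - γ • (1 : Matrix (Fin N) (Fin N) ℝ)).PosSemidef)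
    (hFub : ∀ l, (Γ • (1 : Matrix (Fin N) (Fin N) ℝ) - F l).PosSemidef)
    (hHess : ∀ l, HasFDerivAt (grad q)
      (LinearMap.toContinuousLinearMap (M * (F l)⁻¹ * M).mulVecLin) l)
    (hLip : ∀ l₁ l₂ v : Fin N → ℝ,
      mnorm M ((M * (F l₁)⁻¹ * M - M * (F l₂)⁻¹ * M).mulVec v)
        ≤ B * mnorm M (l₁ - l₂) * mnorm M v)
    (l : Fin N → ℝ) (ds dt : Fin N → ℝ) (ε α : ℝ)
    (hε : 0 ≤ ε) (hα0 : 0 ≤ α) (hα1 : α ≤ 1)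
    (hds : (M * (F l)⁻¹ * M).mulVec ds = -(grad q l))
    (hdt : mnorm (M * (F l)⁻¹ * M) (dt - ds) ≤ ε * mnorm (M * (F l)⁻¹ * M) ds) :
    mnorm M (grad q (l + α • dt))
      ≤ (1 - α + ε * α * Real.sqrt ((Γ / γ) * (μn ^ 3 / μ₂ ^ 3))) * mnorm M (grad q l)
        + B * (α * (1 + ε) * Γ) ^ 2 / (2 * μ₂ ^ 4) * mnorm M (grad q l) ^ 2 := by
  have hμn : 0 < μn := hμ₂.trans_le hμ
  have hΓ0 : 0 < Γ := hγ.trans_le hΓ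
  have hMlb' : ∀ v : Fin N → ℝ, (∀ w : Fin N → ℝ, M *ᵥ w = 0 → v ⬝ᵥ w = 0) →
      μ₂ * (v ⬝ᵥ v) ≤ v ⬝ᵥ M *ᵥ v := fun v hv => by
    simpa [dotProduct, sq] using hMlb v hv
  have hFp := posDef_of_posSemidef_sub_smul_one hγ (hFlb l)
  have hH := posSemidef_mul_inv_mul hM hFp
  have htaylor := mnorm_taylor_remainder_le hM hHess hLip l (α • dt)
  have hHe := mnorm_sq_mul_inv_mul_mulVec_le hM hγ hμn.le hMub (hFlb l) (dt - ds)
  have hMdt := mnorm_sq_le_mul_inv_mul hM hμ₂ hMlb' hFp (hFub l) dt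
  have hHds := mnorm_mul_inv_mul_sq_le hM hμ₂ hΓ0.le hMlb' hFp (hFub l) ds
  set H := M * (F l)⁻¹ * M
  set g := grad q l
  have hneg : mnorm M (-g) = mnorm M g := by
    simpa using mnorm_smul hM (-1) g
  rw [hds, hneg] at hHds
  have hG0 := mnorm_nonneg M g
  have hds0 := mnorm_nonneg H ds
  have hHdt : mnorm H dt ≤ (1 + ε) * mnorm H ds := by
    have := mnorm_add_le hH (dt - ds) ds
    rw [sub_add_cancel] at this
    linarith
  have hlin : mnorm M (H *ᵥ (dt - ds)) ≤
      ε * Real.sqrt ((Γ / γ) * (μn ^ 3 / μ₂ ^ 3)) * mnorm M g := by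
    refine le_of_sq_le_sq ?_ (by positivity)
    rw [mul_pow, mul_pow, Real.sq_sqrt (by positivity)]
    calc mnorm M (H *ᵥ (dt - ds)) ^ 2 ≤ μn ^ 3 / γ * mnorm H (dt - ds) ^ 2 := hHe
      _ ≤ μn ^ 3 / γ * (ε * mnorm H ds) ^ 2 := by
          gcongr
          exact mnorm_nonneg _ _
      _ = μn ^ 3 / γ * ε ^ 2 * mnorm H ds ^ 2 := by ring
      _ ≤ μn ^ 3 / γ * ε ^ 2 * (Γ / μ₂ ^ 3 * mnorm M g ^ 2) := by gcongr
      _ = _ := by field_simp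
  have hquad : mnorm M dt ^ 2 ≤ ((1 + ε) * Γ) ^ 2 / μ₂ ^ 4 * mnorm M g ^ 2 := by
    calc mnorm M dt ^ 2 ≤ Γ / μ₂ * mnorm H dt ^ 2 := hMdt
      _ ≤ Γ / μ₂ * ((1 + ε) * mnorm H ds) ^ 2 := by
          gcongr
          exact mnorm_nonneg _ _
      _ = Γ / μ₂ * (1 + ε) ^ 2 * mnorm H ds ^ 2 := by ring
      _ ≤ Γ / μ₂ * (1 + ε) ^ 2 * (Γ / μ₂ ^ 3 * mnorm M g ^ 2) := by gcongr
      _ = _ := by field_simp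
  rw [mnorm_smul hM, abs_of_nonneg hα0] at htaylor
  have hsplit : grad q (l + α • dt) =
      ((1 - α) • g + α • (H *ᵥ (dt - ds))) + (grad q (l + α • dt) - g - H *ᵥ (α • dt)) := by
    rw [mulVec_sub, hds, mulVec_smul, sub_smul, one_smul, smul_sub, smul_neg]
    abel
  have h1 := mnorm_add_le hM ((1 - α) • g + α • (H *ᵥ (dt - ds)))
    (grad q (l + α • dt) - g - H *ᵥ (α • dt))
  have h2 := mnorm_add_le hM ((1 - α) • g) (α • (H *ᵥ (dt - ds)))
  rw [mnorm_smul hM, mnorm_smul hM, abs_of_nonneg hα0, abs_of_nonneg (sub_nonneg.2 hα1)] at h2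
  rw [← hsplit] at h1
  have h3 := mul_le_mul_of_nonneg_left hlin hα0
  have h4 : B / 2 * (α * mnorm M dt) ^ 2 ≤
      B * (α * (1 + ε) * Γ) ^ 2 / (2 * μ₂ ^ 4) * mnorm M g ^ 2 := by
    calc B / 2 * (α * mnorm M dt) ^ 2 = B / 2 * α ^ 2 * mnorm M dt ^ 2 := by ring
      _ ≤ B / 2 * α ^ 2 * (((1 + ε) * Γ) ^ 2 / μ₂ ^ 4 * mnorm M g ^ 2) := by gcongr
      _ = _ := by field_simp
  linarith
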